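/- arXiv:math/0411129 — 2 statements merged into one kernel-verified Lean document; each statement's English description precedes it below -/
import Mathlib

section
/- Let H be a weak bialgebra over k such that, with the coaction ρ = Δ of H on itself, H is a right H-comodule algebra whose coinvariant subalgebra equals H^L, and suppose the Galois map β : H⊗_{H^L}H → (H⊗H)Δ(1) induced by x⊗y ↦ x y₍₁₎ ⊗ y₍₂₎ is bijective. For h ∈ H write β^{-1}(1₍₁₎ ⊗ h1₍₂₎) = Σ_i ℓ_i(h) ⊗_{H^L} r_i(h). Then the formula S(h) = Σ_i ℓ_i(h)Π^L(r_i(h)) gives a well-defined k-linear map S : H → H satisfying S(h₍₁₎)h₍₂₎ = Π^R(h), h₍₁₎S(h₍₂₎) = Π^L(h) and S(h₍₁₎)h₍₂₎S(h₍₃₎) = S(h) for all h ∈ H; hence H is a weak Hopf algebra. -/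
noncomputable section

open TensorProduct LinearMap

/-- A weak bialgebra over a field `k`: a finite-dimensional `k`-algebra with a `k`-coalgebra
structure whose comultiplication is multiplicative, with the weakened unit and counit axioms. -/
structure WeakBialgebra (k : Type*) [Field k] (H : Type*) [Ring H] [Algebra k H]
    [FiniteDimensional k H] where
  comul : H →ₗ[k] H ⊗[k] H
  counit : H →ₗ[k] k
  coassoc : ∀ x : H,
    (TensorProduct.assoc k H H H) ((rTensor H comul) (comul x)) = (lTensor H comul) (comul x)
  rTensor_counit_comul : ∀ x : H, (TensorProduct.lid k H) ((rTensor H counit) (comul x)) = x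
  lTensor_counit_comul : ∀ x : H, (TensorProduct.rid k H) ((lTensor H counit) (comul x)) = x
  comul_mul : ∀ a b : H, comul (a * b) = comul a * comul b
  -- `1₍₁₎ ⊗ 1₍₂₎ ⊗ 1₍₃₎ = (Δ(1) ⊗ 1)(1 ⊗ Δ(1)) = (1 ⊗ Δ(1))(Δ(1) ⊗ 1)`
  weak_one₁ : (lTensor H comul) (comul 1)
    = (TensorProduct.assoc k H H H) ((comul 1) ⊗ₜ[k] (1 : H)) * ((1 : H) ⊗ₜ[k] (comul 1))
  weak_one₂ : (lTensor H comul) (comul 1)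
    = ((1 : H) ⊗ₜ[k] (comul 1)) * (TensorProduct.assoc k H H H) ((comul 1) ⊗ₜ[k] (1 : H))
  -- `ε(abc) = ε(ab₍₁₎)ε(b₍₂₎c) = ε(ab₍₂₎)ε(b₍₁₎c)`
  weak_counit₁ : ∀ a b c : H, counit (a * b * c)
    = (LinearMap.mul' k k)
        ((TensorProduct.map (counit ∘ₗ mulLeft k a) (counit ∘ₗ mulRight k c)) (comul b))
  weak_counit₂ : ∀ a b c : H, counit (a * b * c)
    = (LinearMap.mul' k k)
        ((TensorProduct.map (counit ∘ₗ mulRight k c) (counit ∘ₗ mulLeft k a)) (comul b))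

namespace WeakBialgebra

variable {k : Type*} [Field k] {H : Type*} [Ring H] [Algebra k H] [FiniteDimensional k H]
variable (wb : WeakBialgebra k H)

/-- `ε ⊗ id : H ⊗ H → H`. -/
def εid : H ⊗[k] H →ₗ[k] H := (TensorProduct.lid k H).toLinearMap ∘ₗ rTensor H wb.counit

/-- `id ⊗ ε : H ⊗ H → H`. -/
def idε : H ⊗[k] H →ₗ[k] H := (TensorProduct.rid k H).toLinearMap ∘ₗ lTensor H wb.counit

/-- `Π^L(x) = ε(1₍₁₎x) 1₍₂₎`. -/
def projL : H →ₗ[k] H :=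
  wb.εid ∘ₗ mulLeft k (wb.comul 1) ∘ₗ (TensorProduct.mk k H H).flip 1

/-- `Π^R(x) = 1₍₁₎ ε(x1₍₂₎)`. -/
def projR : H →ₗ[k] H :=
  wb.idε ∘ₗ mulRight k (wb.comul 1) ∘ₗ TensorProduct.mk k H H 1

/-- `Π̄^L(x) = 1₍₁₎ ε(1₍₂₎x)`. -/
def projBarL : H →ₗ[k] H :=
  wb.idε ∘ₗ mulLeft k (wb.comul 1) ∘ₗ TensorProduct.mk k H H 1

/-- `Π̄^R(x) = ε(x1₍₁₎) 1₍₂₎`. -/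
def projBarR : H →ₗ[k] H :=
  wb.εid ∘ₗ mulRight k (wb.comul 1) ∘ₗ (TensorProduct.mk k H H).flip 1

/-- The antipode axioms for a weak Hopf algebra: `S(x₍₁₎)x₍₂₎ = Π^R(x)`,
`x₍₁₎S(x₍₂₎) = Π^L(x)` and `S(x₍₁₎)x₍₂₎S(x₍₃₎) = S(x)`. -/
structure IsAntipode (S : H →ₗ[k] H) : Prop where
  antipode_left : ∀ x : H, LinearMap.mul' k H ((rTensor H S) (wb.comul x)) = wb.projR x
  antipode_right : ∀ x : H, LinearMap.mul' k H ((lTensor H S) (wb.comul x)) = wb.projL x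
  antipode_mid : ∀ x : H,
    LinearMap.mul' k H
      ((TensorProduct.map (LinearMap.mul' k H ∘ₗ rTensor H S) S)
        ((rTensor H wb.comul) (wb.comul x))) = S x

end WeakBialgebra

/-- A right `H`-comodule algebra over a weak bialgebra `H`. -/
structure ComodAlg {k : Type*} [Field k] {H : Type*} [Ring H] [Algebra k H]
    [FiniteDimensional k H] (wb : WeakBialgebra k H)
    (A : Type*) [Ring A] [Algebra k A] where
  ρ : A →ₗ[k] A ⊗[k] H
  coassoc : ∀ a : A,
    (TensorProduct.assoc k A H H) ((rTensor H ρ) (ρ a)) = (lTensor A wb.comul) (ρ a)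
  counital : ∀ a : A, (TensorProduct.rid k A) ((lTensor A wb.counit) (ρ a)) = a
  mul : ∀ a b : A, ρ (a * b) = ρ a * ρ b
  piL : ∀ a : A, (lTensor A wb.projL) (ρ a) = ρ 1 * (a ⊗ₜ[k] (1 : H))
  pibarR : ∀ a : A, (lTensor A wb.projBarR) (ρ a) = (a ⊗ₜ[k] (1 : H)) * ρ 1

namespace ComodAlg

variable {k : Type*} [Field k] {H : Type*} [Ring H] [Algebra k H] [FiniteDimensional k H]
variable {wb : WeakBialgebra k H} {A : Type*} [Ring A] [Algebra k A]

/-- The coinvariant subalgebra `B = {b ∈ A : ρ(b) = 1₍₀₎b ⊗ 1₍₁₎}`. -/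
def coinv (ca : ComodAlg wb A) : Set A := {b | ca.ρ b = ca.ρ 1 * (b ⊗ₜ[k] (1 : H))}

/-- The `B`-balancing relations in `A ⊗_k A`, realizing `A ⊗_B A`. -/
def rel (ca : ComodAlg wb A) : Submodule k (A ⊗[k] A) :=
  Submodule.span k
    {z | ∃ a a' b : A, b ∈ ca.coinv ∧ z = (a * b) ⊗ₜ[k] a' - a ⊗ₜ[k] (b * a')}

/-- `A ⊗_B A`. -/
abbrev QA (ca : ComodAlg wb A) := (A ⊗[k] A) ⧸ ca.rel

/-- The canonical quotient map `A ⊗_k A → A ⊗_B A`. -/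
def mkA (ca : ComodAlg wb A) : A ⊗[k] A →ₗ[k] ca.QA := ca.rel.mkQ

end ComodAlg

lemma TensorProduct.one_tmul_mul_assoc_tmul_one {k : Type*} [Field k] {H : Type*} [Ring H]
    [Algebra k H] (u w : H ⊗[k] H) :
    ((1 : H) ⊗ₜ[k] u) * (TensorProduct.assoc k H H H) (w ⊗ₜ[k] (1 : H))
      = (TensorProduct.assoc k H H H)
          (rTensor H (mulRight k w ∘ₗ TensorProduct.mk k H H 1) u) := by
  induction u with
  | zero => simp
  | add u u' hu hu' => simp only [tmul_add, add_mul, map_add, hu, hu']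
  | tmul a b =>
    simp only [rTensor_tmul, LinearMap.comp_apply, mulRight_apply, mk_apply]
    induction w with
    | zero => simp
    | add v v' hv hv' => simp only [mul_add, add_tmul, map_add, hv, hv']
    | tmul c d => simp

namespace WeakBialgebra

variable {k : Type*} [Field k] {H : Type*} [Ring H] [Algebra k H] [FiniteDimensional k H]
variable (wb : WeakBialgebra k H)

lemma εid_tmul (a b : H) : wb.εid (a ⊗ₜ[k] b) = wb.counit a • b := by
  simp [εid]

lemma idε_tmul (a b : H) : wb.idε (a ⊗ₜ[k] b) = wb.counit b • a := by
  simp [idε]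

lemma projL_apply (x : H) : wb.projL x = wb.εid (wb.comul 1 * (x ⊗ₜ[k] (1 : H))) := by
  simp [projL]

lemma projR_apply (x : H) : wb.projR x = wb.idε (((1 : H) ⊗ₜ[k] x) * wb.comul 1) := by
  simp [projR]

lemma εid_comul (x : H) : wb.εid (wb.comul x) = x :=
  wb.rTensor_counit_comul x

lemma comul_one_mul_comul (x : H) : wb.comul 1 * wb.comul x = wb.comul x := by
  rw [← wb.comul_mul, one_mul]

lemma comul_mul_comul_one (x : H) : wb.comul x * wb.comul 1 = wb.comul x := by
  rw [← wb.comul_mul, mul_one]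

lemma εid_mul_one_tmul (w : H ⊗[k] H) (c : H) :
    wb.εid (w * ((1 : H) ⊗ₜ[k] c)) = wb.εid w * c := by
  induction w with
  | zero => simp
  | tmul a b => simp [εid_tmul]
  | add u v hu hv => simp [add_mul, hu, hv]

lemma idε_tmul_one_mul (a : H) (w : H ⊗[k] H) :
    wb.idε ((a ⊗ₜ[k] (1 : H)) * w) = a * wb.idε w := by
  induction w with
  | zero => simp
  | tmul b c => simp [idε_tmul]
  | add u v hu hv => simp [mul_add, hu, hv]

/-- `Π^L(a) c = ε(1₍₁₎a) 1₍₂₎c`, for a general tensor in place of `a ⊗ c`. -/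
lemma mul'_rTensor_projL (u : H ⊗[k] H) :
    LinearMap.mul' k H (rTensor H wb.projL u) = wb.εid (wb.comul 1 * u) := by
  induction u with
  | zero => simp
  | tmul a c =>
    rw [rTensor_tmul, mul'_apply, projL_apply, ← εid_mul_one_tmul, mul_assoc,
      Algebra.TensorProduct.tmul_mul_tmul, mul_one, one_mul]
  | add u v hu hv => simp [mul_add, hu, hv]

/-- `Π^L(x₍₁₎)x₍₂₎ = x`. -/
lemma mul'_rTensor_projL_comul (x : H) :
    LinearMap.mul' k H (rTensor H wb.projL (wb.comul x)) = x := by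
  rw [mul'_rTensor_projL, comul_one_mul_comul, εid_comul]

/-- `ε(xΠ^L(y)) = ε(xy)`. -/
lemma counit_mul_projL (x y : H) : wb.counit (x * wb.projL y) = wb.counit (x * y) := by
  have h := wb.weak_counit₂ x 1 y
  rw [mul_one] at h
  rw [h, projL_apply]
  generalize wb.comul 1 = w
  induction w with
  | zero => simp
  | tmul a b => simp [εid_tmul]
  | add u v hu hv => simp [add_mul, mul_add, hu, hv]

/-- `Π^L(xΠ^L(y)) = Π^L(xy)`. -/
lemma projL_mul_projL (x y : H) : wb.projL (x * wb.projL y) = wb.projL (x * y) := by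
  rw [projL_apply _ (x * wb.projL y), projL_apply _ (x * y)]
  generalize wb.comul 1 = w
  induction w with
  | zero => simp
  | tmul a b => simp [εid_tmul, ← mul_assoc, counit_mul_projL]
  | add u v hu hv => simp only [add_mul, map_add, hu, hv]

/-- `id ⊗ Δ` is multiplicative. -/
lemma lTensor_comul_mul (u v : H ⊗[k] H) :
    lTensor H wb.comul (u * v) = lTensor H wb.comul u * lTensor H wb.comul v := by
  induction u with
  | zero => simp
  | add u u' hu hu' => simp only [add_mul, map_add, hu, hu']
  | tmul a b =>
    induction v with
    | zero => simp
    | add v v' hv hv' => simp only [mul_add, map_add, hv, hv']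
    | tmul c d => simp [wb.comul_mul]

/-- `1₍₁₎ ⊗ h₍₁₎1₍₂₎ ⊗ h₍₂₎1₍₃₎ = 1₍₁₎ ⊗ h₍₁₎1₍₂₎ ⊗ h₍₂₎`. -/
lemma lTensor_comul_one_tmul_mul_comul_one (h : H) :
    lTensor H wb.comul (((1 : H) ⊗ₜ[k] h) * wb.comul 1)
      = (TensorProduct.assoc k H H H)
          (rTensor H (mulRight k (wb.comul 1) ∘ₗ TensorProduct.mk k H H 1) (wb.comul h)) := by
  rw [lTensor_comul_mul, wb.weak_one₂, ← mul_assoc, lTensor_tmul,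
    Algebra.TensorProduct.tmul_mul_tmul, mul_one, comul_mul_comul_one,
    one_tmul_mul_assoc_tmul_one]

lemma lTensor_comul_tmul_one_mul_comul (x y : H) :
    lTensor H wb.comul ((x ⊗ₜ[k] (1 : H)) * wb.comul y)
      = (TensorProduct.assoc k H H H)
          (rTensor H (mulLeft k (x ⊗ₜ[k] (1 : H)) ∘ₗ wb.comul) (wb.comul y)) := by
  have h (w : H ⊗[k] H) : lTensor H wb.comul ((x ⊗ₜ[k] (1 : H)) * w)
      = (x ⊗ₜ[k] (1 : H ⊗[k] H)) * lTensor H wb.comul w := by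
    induction w with
    | zero => simp
    | add u v hu hv => simp only [mul_add, map_add, hu, hv]
    | tmul a b => simp
  have h' (v : (H ⊗[k] H) ⊗[k] H) :
      (x ⊗ₜ[k] (1 : H ⊗[k] H)) * (TensorProduct.assoc k H H H) v
        = (TensorProduct.assoc k H H H) (rTensor H (mulLeft k (x ⊗ₜ[k] (1 : H))) v) := by
    induction v with
    | zero => simp
    | add u v hu hv => simp only [mul_add, map_add, hu, hv]
    | tmul a b =>
      induction a with
      | zero => simp
      | add u v hu hv => simp only [mul_add, add_tmul, map_add, hu, hv]
      | tmul c d => simp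
  rw [h, ← wb.coassoc, h', rTensor_comp, LinearMap.comp_apply]

/-- The map `H ⊗ H → H ⊗ H` sending `x ⊗ y` to `x y₍₁₎ ⊗ y₍₂₎`. -/
def galois : H ⊗[k] H →ₗ[k] H ⊗[k] H :=
  TensorProduct.lift ((LinearMap.mul k (H ⊗[k] H)).compl₁₂
    ((TensorProduct.mk k H H).flip 1) wb.comul)

@[simp]
lemma galois_tmul (x y : H) :
    wb.galois (x ⊗ₜ[k] y) = (x ⊗ₜ[k] (1 : H)) * wb.comul y := by
  simp [galois]

lemma galois_tmul_one_mul (a : H) (t : H ⊗[k] H) :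
    wb.galois ((a ⊗ₜ[k] (1 : H)) * t) = (a ⊗ₜ[k] (1 : H)) * wb.galois t := by
  induction t with
  | zero => simp
  | add u v hu hv => simp only [mul_add, map_add, hu, hv]
  | tmul x y => simp [← mul_assoc]

lemma idε_galois (t : H ⊗[k] H) : wb.idε (wb.galois t) = LinearMap.mul' k H t := by
  induction t with
  | zero => simp
  | add u v hu hv => simp only [map_add, hu, hv]
  | tmul x y =>
    rw [galois_tmul, idε_tmul_one_mul, mul'_apply]
    exact congrArg _ (wb.lTensor_counit_comul y)

variable {wb}

lemma retraction_tmul_one_mul_galois {ψ : H ⊗[k] H →ₗ[k] H}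
    (hψ : ∀ x y : H, ψ ((x ⊗ₜ[k] (1 : H)) * wb.comul y) = x * wb.projL y)
    (a : H) (t : H ⊗[k] H) :
    ψ ((a ⊗ₜ[k] (1 : H)) * wb.galois t) = a * ψ (wb.galois t) := by
  rw [← galois_tmul_one_mul]
  induction t with
  | zero => simp
  | add u v hu hv => simp only [mul_add, map_add, hu, hv]
  | tmul x y => simp [hψ, mul_assoc]

lemma mul'_map_retraction_galois {ψ : H ⊗[k] H →ₗ[k] H}
    (hψ : ∀ x y : H, ψ ((x ⊗ₜ[k] (1 : H)) * wb.comul y) = x * wb.projL y)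
    (f g : H →ₗ[k] H)
    (hfg : ∀ y, LinearMap.mul' k H (TensorProduct.map wb.projL f (wb.comul y)) = g y)
    (t : H ⊗[k] H) :
    LinearMap.mul' k H (TensorProduct.map ψ f
      ((TensorProduct.assoc k H H H).symm (lTensor H wb.comul (wb.galois t))))
      = LinearMap.mul' k H (lTensor H g t) := by
  induction t with
  | zero => simp
  | add u v hu hv => simp only [map_add, hu, hv]
  | tmul x y =>
    rw [galois_tmul, lTensor_comul_tmul_one_mul_comul, LinearEquiv.symm_apply_apply,
      lTensor_tmul, mul'_apply, ← hfg]
    generalize wb.comul y = u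
    induction u with
    | zero => simp
    | add u v hu hv => simp only [mul_add, map_add, hu, hv]
    | tmul a c => simp [hψ, mul_assoc]

lemma mul'_map_antipode_comul {ψ : H ⊗[k] H →ₗ[k] H}
    (hψ : ∀ x y : H, ψ ((x ⊗ₜ[k] (1 : H)) * wb.comul y) = x * wb.projL y)
    {S : H →ₗ[k] H} (hS : ∀ h, S h = ψ (((1 : H) ⊗ₜ[k] h) * wb.comul 1))
    (f g : H →ₗ[k] H)
    (hfg : ∀ y, LinearMap.mul' k H (TensorProduct.map wb.projL f (wb.comul y)) = g y)
    (h : H) {t : H ⊗[k] H} (ht : wb.galois t = ((1 : H) ⊗ₜ[k] h) * wb.comul 1) :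
    LinearMap.mul' k H (TensorProduct.map S f (wb.comul h))
      = LinearMap.mul' k H (lTensor H g t) := by
  rw [← mul'_map_retraction_galois hψ f g hfg, ht, lTensor_comul_one_tmul_mul_comul_one,
    LinearEquiv.symm_apply_apply]
  generalize wb.comul h = u
  induction u with
  | zero => simp
  | add u v hu hv => simp only [map_add, hu, hv]
  | tmul a c => simp [hS]

/-- `h₍₁₎S(h₍₂₎) = Π^L(h)`. -/
lemma mul'_lTensor_antipode_comul {ψ : H ⊗[k] H →ₗ[k] H}
    (hψ : ∀ x y : H, ψ ((x ⊗ₜ[k] (1 : H)) * wb.comul y) = x * wb.projL y)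
    {S : H →ₗ[k] H} (hS : ∀ h, S h = ψ (((1 : H) ⊗ₜ[k] h) * wb.comul 1))
    (hsurj : ∀ h : H, ∃ t, wb.galois t = ((1 : H) ⊗ₜ[k] h) * wb.comul 1) (h : H) :
    LinearMap.mul' k H (lTensor H S (wb.comul h)) = wb.projL h := by
  have key (w : H ⊗[k] H) : LinearMap.mul' k H (lTensor H S w) = ψ (w * wb.comul 1) := by
    induction w with
    | zero => simp
    | add u v hu hv => simp only [add_mul, map_add, hu, hv]
    | tmul a b =>
      obtain ⟨t, ht⟩ := hsurj b
      rw [lTensor_tmul, mul'_apply, hS, ← ht, ← retraction_tmul_one_mul_galois hψ, ht,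
        ← mul_assoc, Algebra.TensorProduct.tmul_mul_tmul, mul_one, one_mul]
  have h1 := hψ 1 h
  rw [← Algebra.TensorProduct.one_def, one_mul, one_mul] at h1
  rw [key, comul_mul_comul_one, h1]

lemma isAntipode_of_retraction {ψ : H ⊗[k] H →ₗ[k] H}
    (hψ : ∀ x y : H, ψ ((x ⊗ₜ[k] (1 : H)) * wb.comul y) = x * wb.projL y)
    {S : H →ₗ[k] H} (hS : ∀ h, S h = ψ (((1 : H) ⊗ₜ[k] h) * wb.comul 1))
    (hsurj : ∀ h : H, ∃ t, wb.galois t = ((1 : H) ⊗ₜ[k] h) * wb.comul 1)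
    (hpiL : ∀ a : H, lTensor H wb.projL (wb.comul a) = wb.comul 1 * (a ⊗ₜ[k] (1 : H))) :
    wb.IsAntipode S where
  antipode_left h := by
    obtain ⟨t, ht⟩ := hsurj h
    rw [projR_apply, ← ht, idε_galois]
    simpa [rTensor] using mul'_map_antipode_comul hψ hS LinearMap.id LinearMap.id
      (wb.mul'_rTensor_projL_comul) h ht
  antipode_right := mul'_lTensor_antipode_comul hψ hS hsurj
  antipode_mid h := by
    obtain ⟨t, ht⟩ := hsurj h
    have hproj (y : H) :
        LinearMap.mul' k H (TensorProduct.map wb.projL wb.projL (wb.comul y)) = wb.projL y := by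
      rw [← rTensor_comp_lTensor, LinearMap.comp_apply, mul'_rTensor_projL, hpiL, ← mul_assoc,
        comul_one_mul_comul, ← projL_apply]
    have hright : wb.projL = LinearMap.mul' k H ∘ₗ lTensor H S ∘ₗ wb.comul :=
      LinearMap.ext fun x => (mul'_lTensor_antipode_comul hψ hS hsurj x).symm
    have hassoc (v : (H ⊗[k] H) ⊗[k] H) :
        LinearMap.mul' k H (TensorProduct.map (LinearMap.mul' k H ∘ₗ rTensor H S) S v)
          = LinearMap.mul' k H (TensorProduct.map S (LinearMap.mul' k H ∘ₗ lTensor H S)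
              (TensorProduct.assoc k H H H v)) := by
      induction v with
      | zero => simp
      | add u v hu hv => simp only [map_add, hu, hv]
      | tmul a b =>
        induction a with
        | zero => simp
        | add u v hu hv => simp only [add_tmul, map_add, hu, hv]
        | tmul c d => simp [mul_assoc]
    have hS' : S h = LinearMap.mul' k H (lTensor H wb.projL t) := by
      rw [hS, ← ht]
      clear ht
      induction t with
      | zero => simp
      | add u v hu hv => simp only [map_add, hu, hv]
      | tmul x y => simp [hψ]
    rw [hassoc, wb.coassoc, hS',
      ← mul'_map_antipode_comul hψ hS wb.projL wb.projL hproj h ht]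
    conv_rhs => rw [hright]
    rw [← LinearMap.comp_apply (TensorProduct.map _ _), map_comp_lTensor, LinearMap.comp_assoc]

end WeakBialgebra

namespace ComodAlg

variable {k : Type*} [Field k] {H : Type*} [Ring H] [Algebra k H] [FiniteDimensional k H]
variable {wb : WeakBialgebra k H}

/-- `Π^L(by) = bΠ^L(y)` for `b ∈ H^L`. -/
lemma projL_coinv_mul (ca : ComodAlg wb H) (hρ : ca.ρ = wb.comul)
    (hcoinv : ca.coinv = Set.range ⇑wb.projL) {b : H} (hb : b ∈ ca.coinv) (y : H) :
    wb.projL (b * y) = b * wb.projL y := by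
  have hy : wb.projL y ∈ ca.coinv := hcoinv ▸ Set.mem_range_self y
  simp only [coinv, hρ, Set.mem_ofPred_eq] at hb hy
  have hby : wb.comul (b * wb.projL y)
      = wb.comul 1 * ((b * wb.projL y) ⊗ₜ[k] (1 : H)) := by
    rw [wb.comul_mul, hy, ← mul_assoc, wb.comul_mul_comul_one, hb, mul_assoc,
      Algebra.TensorProduct.tmul_mul_tmul, mul_one]
  rw [← wb.projL_mul_projL, wb.projL_apply, ← hby, wb.εid_comul]

/-- `x ⊗ y ↦ x Π^L(y)` is balanced over the coinvariants. -/
lemma rel_le_ker (ca : ComodAlg wb H) (hρ : ca.ρ = wb.comul)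
    (hcoinv : ca.coinv = Set.range ⇑wb.projL) :
    ca.rel ≤ LinearMap.ker (LinearMap.mul' k H ∘ₗ lTensor H wb.projL) := by
  rw [rel, Submodule.span_le]
  rintro _ ⟨a, a', b, hb, rfl⟩
  simp [ca.projL_coinv_mul hρ hcoinv hb, mul_assoc]

end ComodAlg

/-- let `H` be a weak bialgebra which, with coaction `ρ = Δ`, is a right
`H`-comodule algebra with coinvariants `H^L`, and whose Galois map
`β : H ⊗_{H^L} H → (H ⊗ H)Δ(1)` is bijective.  Writing
`β⁻¹(1₍₁₎ ⊗ h1₍₂₎) = Σᵢ ℓᵢ(h) ⊗ rᵢ(h)`, the formula `S(h) = Σᵢ ℓᵢ(h) Π^L(rᵢ(h))` gives a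
well-defined `k`-linear map satisfying the antipode axioms; hence `H` is a weak Hopf algebra. -/
theorem statement14 {k : Type*} [Field k] {H : Type*} [Ring H] [Algebra k H]
    [FiniteDimensional k H] (wb : WeakBialgebra k H)
    (ca : ComodAlg wb H) (hρ : ca.ρ = wb.comul)
    (hcoinv : ca.coinv = Set.range ⇑wb.projL)
    (β : ca.QA →ₗ[k] H ⊗[k] H)
    (hβ : ∀ x y : H, β (ca.mkA (x ⊗ₜ[k] y)) = (x ⊗ₜ[k] (1 : H)) * wb.comul y)
    (hinj : Function.Injective β)
    (hrange : Set.range ⇑β = Set.range (fun w : H ⊗[k] H => w * wb.comul 1))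
    -- `γ h = β⁻¹(1₍₁₎ ⊗ h1₍₂₎)`
    (γ : H →ₗ[k] ca.QA)
    (hγ : ∀ h : H, β (γ h) = ((1 : H) ⊗ₜ[k] h) * wb.comul 1) :
    ∃ S : H →ₗ[k] H,
      -- `S(h) = Σᵢ ℓᵢ(h) Π^L(rᵢ(h))`, independently of the chosen representation of `γ h`
      (∀ (h : H) (p : ℕ) (x1 x2 : Fin p → H),
        ca.mkA (∑ j, x1 j ⊗ₜ[k] x2 j) = γ h →
        S h = ∑ j, x1 j * wb.projL (x2 j)) ∧
      -- `S` satisfies the antipode axioms, so `H` is a weak Hopf algebra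
      wb.IsAntipode S := by
  let φ : ca.QA →ₗ[k] H := ca.rel.liftQ _ (ca.rel_le_ker hρ hcoinv)
  have hφ (t : H ⊗[k] H) : φ (ca.mkA t) = LinearMap.mul' k H (lTensor H wb.projL t) :=
    Submodule.liftQ_apply _ _ _
  obtain ⟨σ, hσ⟩ := LinearMap.exists_leftInverse_of_injective β (LinearMap.ker_eq_bot.2 hinj)
  have hσβ (q : ca.QA) : σ (β q) = q := LinearMap.congr_fun hσ q
  have hgalois (t : H ⊗[k] H) : wb.galois t = β (ca.mkA t) := by
    induction t with
    | zero => simp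
    | add u v hu hv => simp only [map_add, hu, hv]
    | tmul x y => rw [hβ, wb.galois_tmul]
  refine ⟨φ ∘ₗ γ, fun h p x1 x2 hx => ?_, ?_⟩
  · rw [LinearMap.comp_apply, ← hx, hφ]
    simp
  · refine WeakBialgebra.isAntipode_of_retraction (ψ := φ ∘ₗ σ) (fun x y => ?_) (fun h => ?_)
      (fun h => ?_) (fun a => hρ ▸ ca.piL a)
    · rw [← hβ, LinearMap.comp_apply, hσβ, hφ]
      simp
    · rw [← hγ, LinearMap.comp_apply, LinearMap.comp_apply, hσβ]
    · obtain ⟨t, ht⟩ := Submodule.mkQ_surjective _ (γ h)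
      exact ⟨t, by rw [hgalois, ← hγ, ← ht]; rfl⟩
end
end

section
/- Let H be a weak bialgebra over k and A a right H-comodule algebra with coinvariant subalgebra B such that the Galois map β : A⊗_B A → (A⊗H)ρ(1) is bijective. For h ∈ H write β^{-1}(1₍₀₎ ⊗ h1₍₁₎) = Σ_i ℓ_i(h) ⊗_B r_i(h). Then: (1) Σ_i ℓ_i(h) ⊗ r_i(h)₍₀₎ ⊗ r_i(h)₍₁₎ = Σ_i ℓ_i(h₍₁₎) ⊗ r_i(h₍₁₎) ⊗ h₍₂₎ in (A⊗_B A)⊗H, where the left side is the well-defined map applying ρ to the right tensorand of A⊗_B A; (2) Σ_i a₍₀₎ℓ_i(a₍₁₎) ⊗_B r_i(a₍₁₎) = 1 ⊗_B a in A⊗_B A for all a ∈ A; (3) Σ_i ℓ_i(h)r_i(h) = 1₍₀₎ε(h1₍₁₎) in A, where the product is taken with the well-defined multiplication map A⊗_B A → A. -/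
noncomputable section

open TensorProduct LinearMap

namespace WeakBialgebra

variable {k : Type*} [Field k] {H : Type*} [Ring H] [Algebra k H] [FiniteDimensional k H]
variable (wb : WeakBialgebra k H)

/-- `h ⊗ v ↦ ε(hx) v`. -/
def counitMulRight (x : H) (V : Type*) [AddCommGroup V] [Module k V] : H ⊗[k] V →ₗ[k] V :=
  (TensorProduct.lid k V).toLinearMap ∘ₗ rTensor V (wb.counit ∘ₗ mulRight k x)

@[simp]
theorem counitMulRight_tmul (x : H) (V : Type*) [AddCommGroup V] [Module k V] (h : H) (v : V) :
    wb.counitMulRight x V (h ⊗ₜ[k] v) = wb.counit (h * x) • v := by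
  simp [counitMulRight]

theorem projL_eq_counitMulRight (x : H) : wb.projL x = wb.counitMulRight x H (wb.comul 1) := by
  simp only [projL, εid, LinearMap.comp_apply, mulLeft_apply, flip_apply, TensorProduct.mk_apply]
  generalize wb.comul 1 = w
  induction w with
  | zero => simp
  | tmul a b => simp
  | add a b ha hb => rw [add_mul, map_add, map_add, map_add, ha, hb]

/-- `Δ(Π^L(x)) = Δ(1)(Π^L(x) ⊗ 1)`. -/
theorem comul_projL (x : H) :
    wb.comul (wb.projL x) = wb.comul 1 * (wb.projL x ⊗ₜ[k] (1 : H)) := by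
  have h1 : ∀ w : H ⊗[k] H, wb.comul (wb.counitMulRight x H w)
      = wb.counitMulRight x (H ⊗[k] H) (lTensor H wb.comul w) := fun w => by
    induction w with
    | zero => simp
    | tmul a b => simp
    | add a b ha hb => simp only [map_add, ha, hb]
  have h2 : ∀ D w : H ⊗[k] H, wb.counitMulRight x (H ⊗[k] H)
      (((1 : H) ⊗ₜ[k] D) * (TensorProduct.assoc k H H H) (w ⊗ₜ[k] (1 : H)))
      = D * (wb.counitMulRight x H w ⊗ₜ[k] (1 : H)) := fun D w => by
    induction w with
    | zero => simp
    | tmul a b => simp [← TensorProduct.smul_tmul']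
    | add a b ha hb => simp only [map_add, add_tmul, mul_add, ha, hb]
  rw [projL_eq_counitMulRight, h1, wb.weak_one₂, h2]

end WeakBialgebra

namespace ComodAlg

variable {k : Type*} [Field k] {H : Type*} [Ring H] [Algebra k H] [FiniteDimensional k H]
variable {wb : WeakBialgebra k H} {A : Type*} [Ring A] [Algebra k A] (ca : ComodAlg wb A)

/-- `1₍₀₎ ⊗ Δ(1₍₁₎) = (1 ⊗ Δ(1))(ρ(1) ⊗ 1)`. -/
theorem lTensor_comul_ρ_one : lTensor A wb.comul (ca.ρ 1)
    = ((1 : A) ⊗ₜ[k] wb.comul 1) * (TensorProduct.assoc k A H H) (ca.ρ 1 ⊗ₜ[k] (1 : H)) := by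
  have h1 : ∀ w : A ⊗[k] H, lTensor A wb.comul (lTensor A wb.projL w)
      = ((1 : A) ⊗ₜ[k] wb.comul 1)
        * (TensorProduct.assoc k A H H) (lTensor A wb.projL w ⊗ₜ[k] (1 : H)) := fun w => by
    induction w with
    | zero => simp
    | tmul a b => simp [wb.comul_projL]
    | add a b ha hb => simp only [map_add, add_tmul, mul_add, ha, hb]
  have h2 : lTensor A wb.projL (ca.ρ 1) = ca.ρ 1 := by
    rw [ca.piL, ← Algebra.TensorProduct.one_def, mul_one]
  simpa only [h2] using h1 (ca.ρ 1)

theorem lTensor_comul_mul (w w' : A ⊗[k] H) :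
    lTensor A wb.comul (w * w') = lTensor A wb.comul w * lTensor A wb.comul w' := by
  induction w with
  | zero => simp
  | add a b ha hb => simp only [map_add, add_mul, ha, hb]
  | tmul a b =>
    induction w' with
    | zero => simp
    | add c d hc hd => simp only [map_add, mul_add, hc, hd]
    | tmul c d => simp [wb.comul_mul]

/-- Two linear maps out of `A ⊗_B A` agree if they agree on the classes of pure tensors. -/
theorem QA_ext {V : Type*} [AddCommGroup V] [Module k V] {f g : ca.QA →ₗ[k] V}
    (h : ∀ a a' : A, f (ca.mkA (a ⊗ₜ[k] a')) = g (ca.mkA (a ⊗ₜ[k] a'))) : f = g :=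
  Submodule.linearMap_qext _ (TensorProduct.ext' h)

/-- A `B`-balanced linear map on `A ⊗ A` descends to `A ⊗_B A`. -/
theorem exists_lift {V : Type*} [AddCommGroup V] [Module k V] (f : A ⊗[k] A →ₗ[k] V)
    (h : ∀ a a' b : A, b ∈ ca.coinv → f ((a * b) ⊗ₜ[k] a') = f (a ⊗ₜ[k] (b * a'))) :
    ∃ g : ca.QA →ₗ[k] V, ∀ z, g (ca.mkA z) = f z := by
  refine ⟨ca.rel.liftQ f (Submodule.span_le.2 ?_), fun z => Submodule.liftQ_apply _ _ _⟩
  rintro _ ⟨a, a', b, hb, rfl⟩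
  simp [h a a' b hb]

theorem mkA_balanced (a a' : A) {b : A} (hb : b ∈ ca.coinv) :
    ca.mkA ((a * b) ⊗ₜ[k] a') = ca.mkA (a ⊗ₜ[k] (b * a')) :=
  (Submodule.Quotient.eq ca.rel).2 (Submodule.subset_span ⟨a, a', b, hb, rfl⟩)

/-- The multiplication map `A ⊗_B A → A`. -/
theorem exists_mul : ∃ μ : ca.QA →ₗ[k] A, ∀ a a' : A, μ (ca.mkA (a ⊗ₜ[k] a')) = a * a' := by
  obtain ⟨μ, hμ⟩ := ca.exists_lift (LinearMap.mul' k A) (fun a a' b _ => by simp [mul_assoc])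
  exact ⟨μ, fun a a' => by simp [hμ]⟩

/-- Left multiplication by `A` on the left tensorand of `A ⊗_B A`. -/
theorem exists_leftMul : ∃ lm : A →ₗ[k] ca.QA →ₗ[k] ca.QA,
    ∀ c a a' : A, lm c (ca.mkA (a ⊗ₜ[k] a')) = ca.mkA ((c * a) ⊗ₜ[k] a') := by
  have h (c : A) : ∃ g : ca.QA →ₗ[k] ca.QA, ∀ z, g (ca.mkA z)
      = (ca.mkA ∘ₗ rTensor A (mulLeft k c)) z :=
    ca.exists_lift _ fun a a' b hb => by simp [← mul_assoc, ← ca.mkA_balanced _ _ hb]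
  choose g hg using h
  refine ⟨⟨⟨g, fun c d => ca.QA_ext fun a a' => ?_⟩, fun r c => ca.QA_ext fun a a' => ?_⟩,
    fun c a a' => ?_⟩
  · simp [hg, add_mul, add_tmul]
  · simp [hg, ← TensorProduct.smul_tmul']
  · simp [hg]

/-- If `ρ` is left `B`-linear, then `ρ` may be applied to the right tensorand of `A ⊗_B A`. -/
theorem exists_coactRight
    (hρ : ∀ a b : A, b ∈ ca.coinv → ca.ρ (b * a) = (b ⊗ₜ[k] (1 : H)) * ca.ρ a) :
    ∃ Θ : ca.QA →ₗ[k] ca.QA ⊗[k] H, ∀ a a' : A, Θ (ca.mkA (a ⊗ₜ[k] a'))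
      = (rTensor H (ca.mkA ∘ₗ TensorProduct.mk k A A a)) (ca.ρ a') := by
  have hf (a a' : A) : (rTensor H ca.mkA ∘ₗ (TensorProduct.assoc k A A H).symm.toLinearMap
      ∘ₗ lTensor A ca.ρ) (a ⊗ₜ[k] a')
      = (rTensor H (ca.mkA ∘ₗ TensorProduct.mk k A A a)) (ca.ρ a') := by
    simp only [LinearMap.comp_apply, lTensor_tmul, LinearEquiv.coe_coe]
    generalize ca.ρ a' = w
    induction w with
    | zero => simp
    | tmul c d => simp
    | add c d hc hd => simp only [map_add, tmul_add, hc, hd]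
  obtain ⟨Θ, hΘ⟩ := ca.exists_lift (rTensor H ca.mkA
      ∘ₗ (TensorProduct.assoc k A A H).symm.toLinearMap ∘ₗ lTensor A ca.ρ) fun a a' b hb => by
    rw [hf, hf, hρ a' b hb]
    generalize ca.ρ a' = w
    induction w with
    | zero => simp
    | tmul c d => simp [ca.mkA_balanced _ _ hb]
    | add c d hc hd => simp only [map_add, mul_add, hc, hd]
  exact ⟨Θ, fun a a' => by rw [hΘ, hf]⟩

theorem ρ_mul_of_mem_coinv (β : ca.QA →ₗ[k] A ⊗[k] H)
    (hβ : ∀ a a' : A, β (ca.mkA (a ⊗ₜ[k] a')) = (a ⊗ₜ[k] (1 : H)) * ca.ρ a')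
    (a b : A) (hb : b ∈ ca.coinv) : ca.ρ (b * a) = (b ⊗ₜ[k] (1 : H)) * ca.ρ a := by
  have h := congrArg β (ca.mkA_balanced 1 a hb)
  rw [hβ, hβ, ← Algebra.TensorProduct.one_def, one_mul, one_mul] at h
  exact h.symm

/-- The Galois map is right `H`-colinear. -/
theorem galois_colinear (β : ca.QA →ₗ[k] A ⊗[k] H)
    (hβ : ∀ a a' : A, β (ca.mkA (a ⊗ₜ[k] a')) = (a ⊗ₜ[k] (1 : H)) * ca.ρ a')
    (Θ : ca.QA →ₗ[k] ca.QA ⊗[k] H)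
    (hΘ : ∀ a a' : A, Θ (ca.mkA (a ⊗ₜ[k] a'))
      = (rTensor H (ca.mkA ∘ₗ TensorProduct.mk k A A a)) (ca.ρ a')) (x : ca.QA) :
    TensorProduct.assoc k A H H (rTensor H β (Θ x)) = lTensor A wb.comul (β x) := by
  suffices h : (TensorProduct.assoc k A H H).toLinearMap ∘ₗ rTensor H β ∘ₗ Θ
      = lTensor A wb.comul ∘ₗ β from LinearMap.congr_fun h x
  refine ca.QA_ext fun a a' => ?_
  have h1 : ∀ w : A ⊗[k] H, TensorProduct.assoc k A H H
      (rTensor H β (rTensor H (ca.mkA ∘ₗ TensorProduct.mk k A A a) w))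
      = (a ⊗ₜ[k] (1 : H ⊗[k] H)) * TensorProduct.assoc k A H H (rTensor H ca.ρ w) := fun w => by
    induction w with
    | zero => simp
    | add c d hc hd => simp only [map_add, mul_add, hc, hd]
    | tmul c d =>
      simp only [rTensor_tmul, LinearMap.comp_apply, TensorProduct.mk_apply, hβ]
      generalize ca.ρ c = v
      induction v with
      | zero => simp
      | add c d hc hd => simp only [map_add, mul_add, add_tmul, hc, hd]
      | tmul e f => simp
  have h2 : ∀ w : A ⊗[k] H, (a ⊗ₜ[k] (1 : H ⊗[k] H)) * lTensor A wb.comul w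
      = lTensor A wb.comul ((a ⊗ₜ[k] (1 : H)) * w) := fun w => by
    induction w with
    | zero => simp
    | add c d hc hd => simp only [map_add, mul_add, hc, hd]
    | tmul c d => simp
  simp only [LinearMap.comp_apply, LinearEquiv.coe_coe, hΘ, h1, ca.coassoc, h2, hβ]

/-- The map `h ↦ 1₍₀₎ ⊗ h1₍₁₎` is right `H`-colinear. -/
theorem assoc_rTensor_comul {f : H →ₗ[k] A ⊗[k] H}
    (hf : ∀ h : H, f h = ((1 : A) ⊗ₜ[k] h) * ca.ρ 1) (h : H) :
    TensorProduct.assoc k A H H (rTensor H f (wb.comul h))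
      = lTensor A wb.comul (((1 : A) ⊗ₜ[k] h) * ca.ρ 1) := by
  have h1 : ∀ w : H ⊗[k] H, TensorProduct.assoc k A H H (rTensor H f w)
      = ((1 : A) ⊗ₜ[k] w) * TensorProduct.assoc k A H H (ca.ρ 1 ⊗ₜ[k] (1 : H)) := fun w => by
    induction w with
    | zero => simp
    | add c d hc hd => simp only [map_add, tmul_add, add_mul, hc, hd]
    | tmul c d =>
      rw [rTensor_tmul, hf]
      generalize ca.ρ 1 = v
      induction v with
      | zero => simp
      | add c d hc hd => simp only [map_add, mul_add, add_tmul, hc, hd]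
      | tmul e f => simp
  rw [h1, lTensor_comul_mul, lTensor_comul_ρ_one, lTensor_tmul, ← mul_assoc,
    Algebra.TensorProduct.tmul_mul_tmul, ← wb.comul_mul, mul_one, mul_one]

end ComodAlg

/-- let `H` be a weak bialgebra and `A` a right `H`-comodule algebra with
coinvariants `B` whose Galois map `β : A ⊗_B A → (A ⊗ H)ρ(1)` is bijective.  Writing
`β⁻¹(1₍₀₎ ⊗ h1₍₁₎) = Σᵢ ℓᵢ(h) ⊗_B rᵢ(h)`, one has
(1) `Σᵢ ℓᵢ(h) ⊗ rᵢ(h)₍₀₎ ⊗ rᵢ(h)₍₁₎ = Σᵢ ℓᵢ(h₍₁₎) ⊗ rᵢ(h₍₁₎) ⊗ h₍₂₎`,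
(2) `Σᵢ a₍₀₎ℓᵢ(a₍₁₎) ⊗_B rᵢ(a₍₁₎) = 1 ⊗_B a`, and
(3) `Σᵢ ℓᵢ(h) rᵢ(h) = 1₍₀₎ ε(h1₍₁₎)`. -/
theorem statement15 {k : Type*} [Field k] {H : Type*} [Ring H] [Algebra k H]
    [FiniteDimensional k H] (wb : WeakBialgebra k H)
    {A : Type*} [Ring A] [Algebra k A] (ca : ComodAlg wb A)
    (β : ca.QA →ₗ[k] A ⊗[k] H)
    (hβ : ∀ a a' : A, β (ca.mkA (a ⊗ₜ[k] a')) = (a ⊗ₜ[k] (1 : H)) * ca.ρ a')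
    (hinj : Function.Injective β)
    (hrange : Set.range ⇑β = Set.range (fun w : A ⊗[k] H => w * ca.ρ 1))
    -- `γ h = β⁻¹(1₍₀₎ ⊗ h1₍₁₎)`
    (γ : H →ₗ[k] ca.QA)
    (hγ : ∀ h : H, β (γ h) = ((1 : A) ⊗ₜ[k] h) * ca.ρ 1) :
    ∃ (Θ : ca.QA →ₗ[k] ca.QA ⊗[k] H)      -- `ρ` applied to the right tensorand of `A ⊗_B A`
      (lm : A →ₗ[k] ca.QA →ₗ[k] ca.QA)    -- left multiplication on the left tensorand
      (μ : ca.QA →ₗ[k] A),                -- the multiplication map `A ⊗_B A → A`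
      (∀ a a' : A, Θ (ca.mkA (a ⊗ₜ[k] a'))
        = (LinearMap.rTensor H (ca.mkA ∘ₗ TensorProduct.mk k A A a)) (ca.ρ a')) ∧
      (∀ c a a' : A, lm c (ca.mkA (a ⊗ₜ[k] a')) = ca.mkA ((c * a) ⊗ₜ[k] a')) ∧
      (∀ a a' : A, μ (ca.mkA (a ⊗ₜ[k] a')) = a * a') ∧
      -- (1)
      (∀ h : H, Θ (γ h) = (LinearMap.rTensor H γ) (wb.comul h)) ∧
      -- (2)
      (∀ a : A, (TensorProduct.lift (lm.compl₂ γ)) (ca.ρ a) = ca.mkA ((1 : A) ⊗ₜ[k] a)) ∧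
      -- (3)
      (∀ h : H, μ (γ h)
        = (TensorProduct.rid k A)
            ((LinearMap.lTensor A wb.counit) (((1 : A) ⊗ₜ[k] h) * ca.ρ 1))) := by
  obtain ⟨Θ, hΘ⟩ := ca.exists_coactRight (ca.ρ_mul_of_mem_coinv β hβ)
  obtain ⟨lm, hlm⟩ := ca.exists_leftMul
  obtain ⟨μ, hμ⟩ := ca.exists_mul
  refine ⟨Θ, lm, μ, hΘ, hlm, hμ, fun h => ?_, fun a => hinj ?_, fun h => ?_⟩
  · refine Module.Flat.rTensor_preserves_injective_linearMap (M := H) β hinj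
      ((TensorProduct.assoc k A H H).injective ?_)
    rw [ca.galois_colinear β hβ Θ hΘ, hγ, ← LinearMap.comp_apply (rTensor H β),
      ← rTensor_comp, ca.assoc_rTensor_comul fun h => hγ h]
  · have hβlm (c : A) (x : ca.QA) : β (lm c x) = (c ⊗ₜ[k] (1 : H)) * β x := by
      suffices e : β ∘ₗ lm c = mulLeft k (c ⊗ₜ[k] (1 : H)) ∘ₗ β from LinearMap.congr_fun e x
      exact ca.QA_ext fun a a' => by simp [hlm, hβ, ← mul_assoc]
    have hlift (w : A ⊗[k] H) :
        β (TensorProduct.lift (lm.compl₂ γ) w) = w * ca.ρ 1 := by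
      induction w with
      | zero => simp
      | tmul c d => simp [hβlm, hγ, ← mul_assoc]
      | add c d hc hd => simp only [map_add, add_mul, hc, hd]
    rw [hlift, ← ca.mul, mul_one, hβ, ← Algebra.TensorProduct.one_def, one_mul]
  · rw [← hγ]
    suffices e : μ = (TensorProduct.rid k A).toLinearMap ∘ₗ lTensor A wb.counit ∘ₗ β from
      LinearMap.congr_fun e (γ h)
    refine ca.QA_ext fun a a' => ?_
    have hε (w : A ⊗[k] H) : TensorProduct.rid k A
        (lTensor A wb.counit ((a ⊗ₜ[k] (1 : H)) * w))
        = a * TensorProduct.rid k A (lTensor A wb.counit w) := by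
      induction w with
      | zero => simp
      | tmul c d => simp
      | add c d hc hd => simp only [map_add, mul_add, hc, hd]
    simp only [LinearMap.comp_apply, LinearEquiv.coe_coe, hβ, hμ, hε, ca.counital]
end
end
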